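/- A (2,2)-box state P takes values only in {0,1} if and only if P = ρ_{mnlk} for some m,n,l,k ∈ {0,1}; in particular there are exactly 16 two-valued (2,2)-box states, namely the 16 deterministic states. -/

import Mathlib

namespace BoxWorld

/-- A (2,2)-box assignment: `P a b α β` stands for `P(αβ|ab)`, where the measurement
settings are `a, b ∈ Fin 2` (with `x = 0`, `y = 1`) and the outcomes are `α, β ∈ Fin 2`. -/
abbrev Box : Type := Fin 2 → Fin 2 → Fin 2 → Fin 2 → ℝ

/-- (P1) positivity, (P2) normalization, (P3) non-signalling. -/
def IsState (P : Box) : Prop :=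
  (∀ a b α β, 0 ≤ P a b α β) ∧
  (∀ a b, ∑ α : Fin 2, ∑ β : Fin 2, P a b α β = 1) ∧
  (∀ a b b' α, ∑ β : Fin 2, P a b α β = ∑ β : Fin 2, P a b' α β) ∧
  (∀ a a' b β, ∑ α : Fin 2, P a b α β = ∑ α : Fin 2, P a' b α β)

/-- The set `S` of (2,2)-box states, as a subtype. -/
abbrev State : Type := {P : Box // IsState P}

/-- The deterministic state `ρ_{mnlk}`:
`ρ_{mnlk}(αβ|ab) = 1` iff `α ≡ m·a + n (mod 2)` and `β ≡ l·b + k (mod 2)`. -/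
def detState (m n l k : Fin 2) : Box := fun a b α β =>
  if α = m * a + n ∧ β = l * b + k then 1 else 0

lemma sum_snd (c d α : Fin 2) :
    ∑ β : Fin 2, (if α = c ∧ β = d then (1:ℝ) else 0) = if α = c then 1 else 0 := by
  fin_cases d <;> fin_cases c <;> fin_cases α <;> simp [Fin.sum_univ_two]

lemma sum_fst (c d β : Fin 2) :
    ∑ α : Fin 2, (if α = c ∧ β = d then (1:ℝ) else 0) = if β = d then 1 else 0 := by
  fin_cases d <;> fin_cases c <;> fin_cases β <;> simp [Fin.sum_univ_two]

lemma sum_ind (c : Fin 2) : ∑ α : Fin 2, (if α = c then (1:ℝ) else 0) = 1 := by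
  fin_cases c <;> simp [Fin.sum_univ_two]

lemma detState_isState (m n l k : Fin 2) : IsState (detState m n l k) := by
  refine ⟨fun a b α β => ?_, fun a b => ?_, fun a b b' α => ?_, fun a a' b β => ?_⟩
  · unfold detState; split <;> norm_num
  · simp only [detState, sum_snd, sum_ind]
  · simp only [detState, sum_snd]
  · simp only [detState, sum_fst]

/-- `ρ_{mnlk}` as an element of the state space `S`. -/
def detSt (m n l k : Fin 2) : State := ⟨detState m n l k, detState_isState m n l k⟩

/-- A normalized `{0,1}`-valued function on pairs of outcomes is a point mass. -/
lemma exists_point_mass {p : Fin 2 → Fin 2 → ℝ} (hsum : ∑ α : Fin 2, ∑ β : Fin 2, p α β = 1)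
    (h01 : ∀ α β, p α β = 0 ∨ p α β = 1) :
    ∃ c d : Fin 2, ∀ α β, p α β = if α = c ∧ β = d then 1 else 0 := by
  simp only [Fin.sum_univ_two] at hsum
  rcases h01 0 0 with h₀₀ | h₀₀ <;> rcases h01 0 1 with h₀₁ | h₀₁ <;>
    rcases h01 1 0 with h₁₀ | h₁₀ <;> rcases h01 1 1 with h₁₁ | h₁₁ <;>
    rw [h₀₀, h₀₁, h₁₀, h₁₁] at hsum <;> norm_num at hsum
  · exact ⟨1, 1, by simp [Fin.forall_fin_two, *]⟩
  · exact ⟨1, 0, by simp [Fin.forall_fin_two, *]⟩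
  · exact ⟨0, 1, by simp [Fin.forall_fin_two, *]⟩
  · exact ⟨0, 0, by simp [Fin.forall_fin_two, *]⟩

/-- Every function on `Fin 2` is affine modulo 2. -/
lemma eq_affine (f : Fin 2 → Fin 2) (a : Fin 2) : f a = (f 0 + f 1) * a + f 0 := by
  revert f a
  decide

lemma eq_of_indicator_eq {c c' : Fin 2}
    (h : ∀ α, (if α = c then (1 : ℝ) else 0) = if α = c' then 1 else 0) : c = c' := by
  simpa using h c

/-- A two-valued state is deterministic. -/
lemma exists_eq_detState {P : Box} (hP : IsState P)
    (h01 : ∀ a b α β, P a b α β = 0 ∨ P a b α β = 1) :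
    ∃ m n l k : Fin 2, P = detState m n l k := by
  obtain ⟨-, hnorm, hfst, hsnd⟩ := hP
  choose f g hfg using fun a b => exists_point_mass (hnorm a b) (h01 a b)
  simp only [hfg, sum_snd] at hfst
  simp only [hfg, sum_fst] at hsnd
  have hf : ∀ a b, f a b = f a 0 := fun a b => eq_of_indicator_eq (hfst a b 0)
  have hg : ∀ a b, g a b = g 0 b := fun a b => eq_of_indicator_eq (hsnd a 0 b)
  refine ⟨f 0 0 + f 1 0, f 0 0, g 0 0 + g 0 1, g 0 0, ?_⟩
  funext a b α β
  rw [hfg, hf, hg, detState, ← eq_affine (fun a => f a 0) a, ← eq_affine (g 0) b]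

lemma detState_eq_zero_or_one (m n l k a b α β : Fin 2) :
    detState m n l k a b α β = 0 ∨ detState m n l k a b α β = 1 := by
  unfold detState
  split <;> simp

lemma affine_injective {m n m' n' : Fin 2} (h : ∀ a, m * a + n = m' * a + n') :
    m = m' ∧ n = n' := by
  revert m n m' n'
  decide

lemma detState_injective :
    Function.Injective fun q : Fin 2 × Fin 2 × Fin 2 × Fin 2 =>
      detState q.1 q.2.1 q.2.2.1 q.2.2.2 := by
  rintro ⟨m, n, l, k⟩ ⟨m', n', l', k'⟩ h
  have key : ∀ a b, m * a + n = m' * a + n' ∧ l * b + k = l' * b + k' := fun a b => by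
    simpa [detState] using congrFun (congrFun (congrFun (congrFun h a) b) (m * a + n)) (l * b + k)
  obtain ⟨rfl, rfl⟩ := affine_injective fun a => (key a 0).1
  obtain ⟨rfl, rfl⟩ := affine_injective fun b => (key 0 b).2
  rfl

/-- a (2,2)-box state takes values only in `{0,1}` iff it is one of the
deterministic states `ρ_{mnlk}`; in particular there are exactly 16 two-valued
(2,2)-box states. -/
theorem two_valued_states_are_deterministic :
    (∀ P : Box, IsState P →
      ((∀ a b α β, P a b α β = 0 ∨ P a b α β = 1) ↔
        ∃ m n l k : Fin 2, P = detState m n l k)) ∧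
    Set.ncard {P : Box | IsState P ∧ ∀ a b α β, P a b α β = 0 ∨ P a b α β = 1} = 16 := by
  refine ⟨fun P hP => ⟨exists_eq_detState hP, ?_⟩, ?_⟩
  · rintro ⟨m, n, l, k, rfl⟩
    exact detState_eq_zero_or_one m n l k
  · have hrange : {P : Box | IsState P ∧ ∀ a b α β, P a b α β = 0 ∨ P a b α β = 1} =
        Set.range fun q : Fin 2 × Fin 2 × Fin 2 × Fin 2 =>
          detState q.1 q.2.1 q.2.2.1 q.2.2.2 := by
      ext P
      constructor
      · rintro ⟨hP, h01⟩
        obtain ⟨m, n, l, k, rfl⟩ := exists_eq_detState hP h01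
        exact ⟨(m, n, l, k), rfl⟩
      · rintro ⟨⟨m, n, l, k⟩, rfl⟩
        exact ⟨detState_isState m n l k, detState_eq_zero_or_one m n l k⟩
    rw [hrange, ← Set.image_univ, Set.ncard_image_of_injective _ detState_injective,
      Set.ncard_univ]
    simp

end BoxWorld
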